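/- arXiv:2510.07788 — 4 statements merged into one kernel-verified Lean document; each statement's English description precedes it below -/
import Mathlib

section
/- One-step Clebsch–Gordan coefficients versus dimension ratios: for every Young diagram λ with at most d rows and all i, k ∈ [d], the following three identities of rational numbers hold: (i) c²_{k→i} = D_{k→i} − D_{k−1→i}; (ii) (C_i − C_k) · c²_{k→i} = D_{k−1→i}; (iii) (C_i − C_k) · D_{k→i} = (C_i − C_k + 1) · D_{k−1→i}. -/
open Finset

/-- The Weyl dimension polynomial `WD_p(mu) = prod_{1 <= a < b <= p} ((mu_a - mu_b) + (b - a))/(b - a)`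
of the integer tuple `(mu 1, ..., mu p)`. -/
def weylDim (p : ℕ) (μ : ℕ → ℤ) : ℚ :=
  ∏ a ∈ Finset.Icc 1 p, ∏ b ∈ Finset.Icc (a + 1) p,
    (((μ a : ℚ) - (μ b : ℚ)) + ((b : ℚ) - (a : ℚ))) / ((b : ℚ) - (a : ℚ))

/-- `addBox μ y = μ + e_y`: the tuple `μ` with `1` added in coordinate `y`. -/
def addBox (μ : ℕ → ℤ) (y : ℕ) : ℕ → ℤ := fun x => μ x + if x = y then 1 else 0

/-- The dimension ratio `D^μ_{k→y} = WD_k(μ + e_y)/WD_k(μ)` for `y ≤ k`, and `0` for `k < y`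
(division by zero evaluates to `0`). -/
def dimRatio (μ : ℕ → ℤ) (k y : ℕ) : ℚ :=
  if y ≤ k then weylDim k (addBox μ y) / weylDim k μ else 0

/-- `D_{k→i}` for the Young diagram `lam`. -/
def dimR (lam : ℕ → ℕ) (k i : ℕ) : ℚ := dimRatio (fun x => (lam x : ℤ)) k i

/-- The squared one-step Clebsch–Gordan coefficient `c²_{k→i}`. -/
def csq (lam : ℕ → ℕ) (k i : ℕ) : ℚ :=
  if i ≤ k then
    |(∏ j ∈ (Finset.Icc 1 (k - 1)).erase i,
        ((((lam j : ℚ) - (lam i : ℚ)) + ((i : ℚ) - (j : ℚ))) - 1) /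
          (((lam j : ℚ) - (lam i : ℚ)) + ((i : ℚ) - (j : ℚ)))) *
      (1 / ((((lam i : ℚ) - (lam k : ℚ)) + ((k : ℚ) - (i : ℚ))) + (if i = k then 1 else 0)))|
  else 0

/-- The content `C_x = λ_x − x` of row `x`. -/
def rowContent (lam : ℕ → ℕ) (x : ℕ) : ℚ := (lam x : ℚ) - (x : ℚ)

/-- The factor contributed by row `j` to the dimension ratio when a box is added in row `i`. -/
def boxFactor (μ : ℕ → ℤ) (i j : ℕ) : ℚ :=
  ((((μ j : ℚ) - (μ i : ℚ)) + ((i : ℚ) - (j : ℚ))) - 1) /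
    (((μ j : ℚ) - (μ i : ℚ)) + ((i : ℚ) - (j : ℚ)))

lemma weylDim_succ (p : ℕ) (μ : ℕ → ℤ) :
    weylDim (p + 1) μ = weylDim p μ * ∏ a ∈ Finset.Icc 1 p,
      (((μ a : ℚ) - (μ (p + 1) : ℚ)) + (((p + 1 : ℕ) : ℚ) - (a : ℚ))) /
        (((p + 1 : ℕ) : ℚ) - (a : ℚ)) := by
  unfold weylDim
  rw [Finset.prod_Icc_succ_top (by omega), Finset.Icc_eq_empty_of_lt (a := p + 1 + 1) (by omega),
    Finset.prod_empty, mul_one, ← Finset.prod_mul_distrib]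
  refine Finset.prod_congr rfl fun a ha => ?_
  rw [Finset.mem_Icc] at ha
  rw [Finset.prod_Icc_succ_top (by omega)]

lemma one_le_row_diff {μ : ℕ → ℤ} {k a b : ℕ}
    (hμ : ∀ a b, 1 ≤ a → a < b → b ≤ k → μ b ≤ μ a) (ha : 1 ≤ a) (hab : a < b) (hb : b ≤ k) :
    1 ≤ ((μ a : ℚ) - (μ b : ℚ)) + ((b : ℚ) - (a : ℚ)) := by
  have h1 : (μ b : ℚ) ≤ μ a := by exact_mod_cast hμ a b ha hab hb
  have h2 : (a : ℚ) + 1 ≤ b := by exact_mod_cast hab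
  linarith

lemma weylDim_pos {μ : ℕ → ℤ} {k : ℕ} (hμ : ∀ a b, 1 ≤ a → a < b → b ≤ k → μ b ≤ μ a) :
    0 < weylDim k μ := by
  refine Finset.prod_pos fun a ha => Finset.prod_pos fun b hb => ?_
  rw [Finset.mem_Icc] at ha hb
  have h := one_le_row_diff hμ ha.1 (b := b) (by omega) hb.2
  have h2 : (a : ℚ) + 1 ≤ b := by exact_mod_cast hb.1
  exact div_pos (by linarith) (by linarith)

lemma weylDim_addBox_of_lt {μ : ℕ → ℤ} {k i : ℕ} (hki : k < i) :
    weylDim k (addBox μ i) = weylDim k μ := by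
  refine Finset.prod_congr rfl fun a ha => Finset.prod_congr rfl fun b hb => ?_
  rw [Finset.mem_Icc] at ha hb
  simp [addBox, show a ≠ i by omega, show b ≠ i by omega]

lemma weylDim_addBox {μ : ℕ → ℤ} {k i : ℕ} (hi : 1 ≤ i) (hik : i ≤ k)
    (hμ : ∀ a b, 1 ≤ a → a < b → b ≤ k → μ b ≤ μ a) :
    weylDim k (addBox μ i) = weylDim k μ * ∏ j ∈ (Finset.Icc 1 k).erase i, boxFactor μ i j := by
  induction k with
  | zero => omega
  | succ p ih =>
    rw [weylDim_succ, weylDim_succ]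
    rcases Nat.lt_or_ge p i with hpi | hip
    · obtain rfl : i = p + 1 := by omega
      have herase : (Finset.Icc 1 (p + 1)).erase (p + 1) = Finset.Icc 1 p := by
        ext x; simp only [Finset.mem_erase, Finset.mem_Icc]; omega
      rw [weylDim_addBox_of_lt hpi, herase, mul_assoc, ← Finset.prod_mul_distrib]
      congr 1
      refine Finset.prod_congr rfl fun a ha => ?_
      rw [Finset.mem_Icc] at ha
      have h := one_le_row_diff hμ ha.1 (b := p + 1) (by omega) le_rfl
      simp only [addBox, boxFactor, show a ≠ p + 1 by omega, if_true, if_false]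
      rw [div_mul_div_comm, mul_comm (((p + 1 : ℕ) : ℚ) - a), mul_div_mul_left _ _ (by linarith)]
      push_cast
      ring
    · have herase : (Finset.Icc 1 (p + 1)).erase i =
          insert (p + 1) ((Finset.Icc 1 p).erase i) := by
        ext x; simp only [Finset.mem_erase, Finset.mem_Icc, Finset.mem_insert]; omega
      have hmem : i ∈ Finset.Icc 1 p := Finset.mem_Icc.2 ⟨hi, hip⟩
      rw [ih hip fun a b ha hab hb => hμ a b ha hab (by omega), herase,
        Finset.prod_insert (by simp), ← Finset.mul_prod_erase _ _ hmem,
        ← Finset.mul_prod_erase (Finset.Icc 1 p) (fun a : ℕ =>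
          (((μ a : ℚ) - (μ (p + 1) : ℚ)) + (((p + 1 : ℕ) : ℚ) - (a : ℚ))) /
            (((p + 1 : ℕ) : ℚ) - (a : ℚ))) hmem]
      have hrest : ∏ a ∈ (Finset.Icc 1 p).erase i,
            (((addBox μ i a : ℚ) - (addBox μ i (p + 1) : ℚ)) + (((p + 1 : ℕ) : ℚ) - (a : ℚ))) /
              (((p + 1 : ℕ) : ℚ) - (a : ℚ)) =
          ∏ a ∈ (Finset.Icc 1 p).erase i,
            (((μ a : ℚ) - (μ (p + 1) : ℚ)) + (((p + 1 : ℕ) : ℚ) - (a : ℚ))) /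
              (((p + 1 : ℕ) : ℚ) - (a : ℚ)) := by
        refine Finset.prod_congr rfl fun a ha => ?_
        simp [addBox, (Finset.mem_erase.1 ha).1, show p + 1 ≠ i by omega]
      have hfactor : (((addBox μ i i : ℚ) - (addBox μ i (p + 1) : ℚ)) +
            (((p + 1 : ℕ) : ℚ) - (i : ℚ))) / (((p + 1 : ℕ) : ℚ) - (i : ℚ)) =
          (((μ i : ℚ) - (μ (p + 1) : ℚ)) + (((p + 1 : ℕ) : ℚ) - (i : ℚ))) /
            (((p + 1 : ℕ) : ℚ) - (i : ℚ)) * boxFactor μ i (p + 1) := by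
        have h := one_le_row_diff hμ hi (b := p + 1) (by omega) le_rfl
        have hne : ((μ (p + 1) : ℚ) - (μ i : ℚ)) + ((i : ℚ) - ((p + 1 : ℕ) : ℚ)) ≠ 0 := by
          intro h0; linarith
        have hne' : ((p + 1 : ℕ) : ℚ) - (i : ℚ) ≠ 0 := by
          have : (i : ℚ) + 1 ≤ ((p + 1 : ℕ) : ℚ) := by exact_mod_cast Nat.succ_le_succ hip
          intro h0; linarith
        simp only [addBox, boxFactor, show p + 1 ≠ i by omega, if_true, if_false]
        rw [div_mul_div_comm, div_eq_div_iff hne' (mul_ne_zero hne' hne)]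
        push_cast
        ring
      rw [hrest, hfactor]
      ring

lemma dimRatio_eq_prod {μ : ℕ → ℤ} {k i : ℕ} (hi : 1 ≤ i) (hik : i ≤ k)
    (hμ : ∀ a b, 1 ≤ a → a < b → b ≤ k → μ b ≤ μ a) :
    dimRatio μ k i = ∏ j ∈ (Finset.Icc 1 k).erase i, boxFactor μ i j := by
  rw [dimRatio, if_pos hik, weylDim_addBox hi hik hμ, mul_div_cancel_left₀ _ (weylDim_pos hμ).ne']

lemma boxFactor_nonneg {μ : ℕ → ℤ} {k i j : ℕ} (hi : 1 ≤ i) (hik : i ≤ k) (hj : 1 ≤ j)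
    (hjk : j ≤ k) (hji : j ≠ i) (hμ : ∀ a b, 1 ≤ a → a < b → b ≤ k → μ b ≤ μ a) :
    0 ≤ boxFactor μ i j := by
  rcases Nat.lt_or_gt_of_ne hji with h | h
  · have := one_le_row_diff hμ hj h hik
    exact div_nonneg (by linarith) (by linarith)
  · have := one_le_row_diff hμ hi h hjk
    exact div_nonneg_of_nonpos (by linarith) (by linarith)

lemma row_le_row_of_succ_le {lam : ℕ → ℕ} {d : ℕ}
    (hlam : ∀ k, 1 ≤ k → k + 1 ≤ d → lam (k + 1) ≤ lam k) {a b : ℕ} (ha : 1 ≤ a) (hab : a ≤ b)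
    (hb : b ≤ d) : lam b ≤ lam a := by
  induction b, hab using Nat.le_induction with
  | base => exact le_rfl
  | succ n hn ih => exact (hlam n (by omega) hb).trans (ih (by omega))

lemma csq_eq_abs {lam : ℕ → ℕ} {k i : ℕ} (hik : i ≤ k) :
    csq lam k i = |(∏ j ∈ (Finset.Icc 1 (k - 1)).erase i, boxFactor (fun x => (lam x : ℤ)) i j) *
      (1 / ((((lam i : ℚ) - (lam k : ℚ)) + ((k : ℚ) - (i : ℚ))) + (if i = k then 1 else 0)))| := by
  rw [csq, if_pos hik]
  simp only [boxFactor, Int.cast_natCast]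

theorem one_step_CG_vs_dimension_ratios
    (d : ℕ) (hd : 1 ≤ d) (lam : ℕ → ℕ)
    (hlam : ∀ k, 1 ≤ k → k + 1 ≤ d → lam (k + 1) ≤ lam k)
    (i k : ℕ) (hi : i ∈ Finset.Icc 1 d) (hk : k ∈ Finset.Icc 1 d) :
    csq lam k i = dimR lam k i - dimR lam (k - 1) i ∧
      (rowContent lam i - rowContent lam k) * csq lam k i = dimR lam (k - 1) i ∧
      (rowContent lam i - rowContent lam k) * dimR lam k i
        = (rowContent lam i - rowContent lam k + 1) * dimR lam (k - 1) i := by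
  rw [Finset.mem_Icc] at hi hk
  have hμ : ∀ a b, 1 ≤ a → a < b → b ≤ k → (lam b : ℤ) ≤ (lam a : ℤ) := fun a b ha hab hb => by
    exact_mod_cast row_le_row_of_succ_le hlam ha hab.le (hb.trans hk.2)
  obtain ⟨p, rfl⟩ : ∃ p, k = p + 1 := ⟨k - 1, by omega⟩
  rw [Nat.add_sub_cancel]
  rcases lt_trichotomy i (p + 1) with hik | rfl | hik
  · have hip : i ≤ p := by omega
    have herase : (Finset.Icc 1 (p + 1)).erase i =
        insert (p + 1) ((Finset.Icc 1 p).erase i) := by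
      ext x; simp only [Finset.mem_erase, Finset.mem_Icc, Finset.mem_insert]; omega
    have hgap := one_le_row_diff hμ hi.1 hik le_rfl
    simp only [Int.cast_natCast] at hgap
    have hnonneg : 0 ≤ ∏ j ∈ (Finset.Icc 1 p).erase i, boxFactor (fun x => (lam x : ℤ)) i j := by
      refine Finset.prod_nonneg fun j hj => ?_
      rw [Finset.mem_erase, Finset.mem_Icc] at hj
      exact boxFactor_nonneg hi.1 hik.le hj.2.1 (by omega) hj.1 hμ
    rw [csq_eq_abs hik.le, dimR, dimR, dimRatio_eq_prod hi.1 hik.le hμ,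
      dimRatio_eq_prod hi.1 hip fun a b ha hab hb => hμ a b ha hab (by omega), herase,
      Finset.prod_insert (by simp), Nat.add_sub_cancel, if_neg hik.ne, add_zero,
      abs_of_nonneg (mul_nonneg hnonneg (one_div_nonneg.2 (by linarith)))]
    generalize ∏ j ∈ (Finset.Icc 1 p).erase i, boxFactor (fun x => (lam x : ℤ)) i j = P
    have hfactor : boxFactor (fun x => (lam x : ℤ)) i (p + 1) =
        1 + 1 / (((lam i : ℚ) - (lam (p + 1) : ℚ)) + (((p + 1 : ℕ) : ℚ) - (i : ℚ))) := by
      simp only [boxFactor, Int.cast_natCast]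
      rw [← neg_div_neg_eq, eq_comm, one_add_div (by linarith)]
      congr 1 <;> ring
    have hcontent : rowContent lam i - rowContent lam (p + 1) =
        ((lam i : ℚ) - (lam (p + 1) : ℚ)) + (((p + 1 : ℕ) : ℚ) - (i : ℚ)) := by
      simp only [rowContent]; ring
    rw [hfactor, hcontent]
    generalize ((lam i : ℚ) - (lam (p + 1) : ℚ)) + (((p + 1 : ℕ) : ℚ) - (i : ℚ)) = g
      at hgap ⊢
    have hg : g ≠ 0 := by intro h0; linarith
    refine ⟨by ring, by field_simp, by field_simp⟩
  · have herase : (Finset.Icc 1 (p + 1)).erase (p + 1) = (Finset.Icc 1 p).erase (p + 1) := by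
      ext x; simp only [Finset.mem_erase, Finset.mem_Icc]; omega
    have hzero : dimR lam p (p + 1) = 0 := if_neg (by omega)
    have hnonneg : 0 ≤ ∏ j ∈ (Finset.Icc 1 p).erase (p + 1),
        boxFactor (fun x => (lam x : ℤ)) (p + 1) j := by
      refine Finset.prod_nonneg fun j hj => ?_
      rw [Finset.mem_erase, Finset.mem_Icc] at hj
      exact boxFactor_nonneg hi.1 le_rfl hj.2.1 (by omega) hj.1 hμ
    refine ⟨?_, by simp [hzero], by simp [hzero]⟩
    rw [hzero, sub_zero, csq_eq_abs le_rfl, dimR, dimRatio_eq_prod hi.1 le_rfl hμ, herase]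
    rw [Nat.add_sub_cancel, if_pos rfl, sub_self, sub_self, add_zero, zero_add, one_div_one, mul_one,
      abs_of_nonneg hnonneg]
  · have hcsq : csq lam (p + 1) i = 0 := if_neg (by omega)
    have hsucc : dimR lam (p + 1) i = 0 := if_neg (by omega)
    have hpred : dimR lam p i = 0 := if_neg (by omega)
    simp [hcsq, hsucc, hpred]
end

section
/- Block constancy of one-step Clebsch–Gordan coefficients: for every Young diagram λ with at most d rows, every i ∈ [d], and all k, k' ∈ [d] with λ_k = λ_{k'}, one has c²_{k→i} = c²_{k'→i}. (Since λ is weakly decreasing, λ_k = λ_{k'} exactly says that k and k' lie in a common block of λ.) -/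
open Finset

theorem lam_antitone {d : ℕ} {lam : ℕ → ℕ}
    (hlam : ∀ k, 1 ≤ k → k + 1 ≤ d → lam (k + 1) ≤ lam k) {a b : ℕ} (ha : 1 ≤ a)
    (hab : a ≤ b) (hb : b ≤ d) : lam b ≤ lam a := by
  induction b, hab using Nat.le_induction with
  | base => exact le_rfl
  | succ b hab ih => exact (hlam b (ha.trans hab) hb).trans (ih (by omega))

theorem csq_succ_eq {lam : ℕ → ℕ} {i k : ℕ} (hk : 1 ≤ k) (hle : i ≤ k → lam k ≤ lam i)
    (hblock : lam (k + 1) = lam k) : csq lam (k + 1) i = csq lam k i := by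
  obtain h | rfl | rfl | h : k + 1 < i ∨ i = k + 1 ∨ i = k ∨ i < k := by omega
  · rw [csq, csq, if_neg (by omega), if_neg (by omega)]
  · rw [csq, csq, if_pos le_rfl, if_neg (show ¬k + 1 ≤ k by omega), Finset.prod_eq_zero (i := k)]
    · simp
    · simp [hk]
    · simp [hblock]
  · have hset : (Finset.Icc 1 i).erase i = (Finset.Icc 1 (i - 1)).erase i := by
      ext j
      simp only [Finset.mem_erase, Finset.mem_Icc]
      omega
    simp [csq, hblock, hset]
  · have hset : (Finset.Icc 1 (k + 1 - 1)).erase i =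
        insert k ((Finset.Icc 1 (k - 1)).erase i) := by
      ext j
      simp only [Finset.mem_erase, Finset.mem_Icc, Finset.mem_insert]
      omega
    have hnot : k ∉ (Finset.Icc 1 (k - 1)).erase i := by
      simp only [Finset.mem_erase, Finset.mem_Icc]
      omega
    have hhook : (0 : ℚ) < (lam i : ℚ) - lam k + ((k : ℚ) - i) := by
      have hcontent : (lam k : ℚ) ≤ lam i := by exact_mod_cast hle h.le
      have hrow : (i : ℚ) < k := by exact_mod_cast h
      linarith
    have hden : (lam k : ℚ) - lam i + ((i : ℚ) - k) ≠ 0 := by linarith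
    have hden' : (lam i : ℚ) - lam k + ((k : ℚ) + 1 - i) ≠ 0 := by linarith
    have hcancel : ((lam k : ℚ) - lam i + ((i : ℚ) - k) - 1) /
        ((lam k : ℚ) - lam i + ((i : ℚ) - k)) *
        (1 / ((lam i : ℚ) - lam k + ((k : ℚ) + 1 - i))) =
        1 / ((lam i : ℚ) - lam k + ((k : ℚ) - i)) := by
      rw [div_mul_div_comm, div_eq_div_iff (mul_ne_zero hden hden') hhook.ne']
      ring
    rw [csq, csq, if_pos (by omega), if_pos h.le, hset, Finset.prod_insert hnot,
      if_neg (by omega), if_neg h.ne, hblock, add_zero, add_zero, Nat.cast_succ,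
      mul_right_comm, hcancel, mul_comm]

theorem csq_eq_of_le {d : ℕ} {lam : ℕ → ℕ}
    (hlam : ∀ k, 1 ≤ k → k + 1 ≤ d → lam (k + 1) ≤ lam k) {i k k' : ℕ} (hi : 1 ≤ i)
    (hk : 1 ≤ k) (hkk' : k ≤ k') (hk' : k' ≤ d) (hblock : lam k = lam k') :
    csq lam k i = csq lam k' i := by
  induction k', hkk' using Nat.le_induction with
  | base => rfl
  | succ m hkm ih =>
    have hle : lam m ≤ lam k := lam_antitone hlam hk hkm (by omega)
    have hstep := hlam m (hk.trans hkm) hk'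
    rw [ih (by omega) (by omega), csq_succ_eq (hk.trans hkm)
      (fun him => lam_antitone hlam hi him (by omega)) (by omega)]

theorem block_constancy_one_step_CG
    (d : ℕ) (hd : 1 ≤ d) (lam : ℕ → ℕ)
    (hlam : ∀ k, 1 ≤ k → k + 1 ≤ d → lam (k + 1) ≤ lam k)
    (i k k' : ℕ) (hi : i ∈ Finset.Icc 1 d) (hk : k ∈ Finset.Icc 1 d)
    (hk' : k' ∈ Finset.Icc 1 d) (hblock : lam k = lam k') :
    csq lam k i = csq lam k' i := by
  rw [Finset.mem_Icc] at hi hk hk'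
  rcases le_total k k' with h | h
  · exact csq_eq_of_le hlam hi.1 hk.1 h hk'.2 hblock
  · exact (csq_eq_of_le hlam hi.1 hk'.1 h hk.2 hblock.symm).symm
end

section
/- The staircase transformation is a legal Young-diagram transformation: for every Young diagram λ with at most d rows and every block B of λ, one has ∑_{k∈B} λ↑↑_k = ∑_{k∈B} λ↑_k, where λ↑↑_k := λ_k + d − 2k + 1. -/
open Finset

/-- The box-donation transformation `λ↑`. -/
def donate (d : ℕ) (lam : ℕ → ℕ) (k : ℕ) : ℤ :=
  (lam k : ℤ)
    - (((Finset.Icc 1 d).filter fun j => j < k ∧ lam k < lam j).card : ℤ)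
    + (((Finset.Icc 1 d).filter fun j => k < j ∧ lam j < lam k).card : ℤ)

/-- `IsBlock d lam a b`: the consecutive indices `{a, …, b} ⊆ [d]` form a block of `lam`. -/
def IsBlock (d : ℕ) (lam : ℕ → ℕ) (a b : ℕ) : Prop :=
  1 ≤ a ∧ a ≤ b ∧ b ≤ d ∧ lam a = lam b ∧
    (a = 1 ∨ lam a < lam (a - 1)) ∧ (b = d ∨ lam (b + 1) < lam b)

/-- The staircase transformation `λ↑↑_k = λ_k + d − 2k + 1`. -/
def staircase (d : ℕ) (lam : ℕ → ℕ) (k : ℕ) : ℤ :=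
  (lam k : ℤ) + (d : ℤ) - 2 * (k : ℤ) + 1

/-- Weak decrease of consecutive entries on `[d]` gives weak decrease on `[d]`. -/
lemma le_of_succ_le_on_Icc {d : ℕ} {lam : ℕ → ℕ}
    (hlam : ∀ k, 1 ≤ k → k + 1 ≤ d → lam (k + 1) ≤ lam k)
    {i j : ℕ} (hi : 1 ≤ i) (hij : i ≤ j) (hj : j ≤ d) : lam j ≤ lam i := by
  induction j, hij using Nat.le_induction with
  | base => exact le_rfl
  | succ n hn ih => exact (hlam n (hi.trans hn) hj).trans (ih (by omega))

/-- On a block `{a, …, b}` every entry donates `a - 1` boxes and receives `d - b` boxes. -/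
lemma donate_eq_of_mem_block {d : ℕ} {lam : ℕ → ℕ}
    (hlam : ∀ k, 1 ≤ k → k + 1 ≤ d → lam (k + 1) ≤ lam k)
    {a b k : ℕ} (hB : IsBlock d lam a b) (hk : k ∈ Finset.Icc a b) :
    donate d lam k = (lam k : ℤ) - ((a : ℤ) - 1) + ((d : ℤ) - b) := by
  obtain ⟨ha, hab, hbd, hlab, hleft, hright⟩ := hB
  obtain ⟨hak, hkb⟩ := Finset.mem_Icc.mp hk
  have hka : lam k ≤ lam a := le_of_succ_le_on_Icc hlam ha hak (hkb.trans hbd)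
  have hbk : lam b ≤ lam k := le_of_succ_le_on_Icc hlam (ha.trans hak) hkb hbd
  have hbefore : ((Finset.Icc 1 d).filter fun j => j < k ∧ lam k < lam j) =
      Finset.Ico 1 a := by
    ext j
    simp only [Finset.mem_filter, Finset.mem_Icc, Finset.mem_Ico]
    constructor
    · rintro ⟨⟨h1, h2⟩, h3, h4⟩
      refine ⟨h1, ?_⟩
      by_contra! h
      have := le_of_succ_le_on_Icc hlam ha h h2
      omega
    · rintro ⟨h1, h2⟩
      have := le_of_succ_le_on_Icc hlam h1 (show j ≤ a - 1 by omega) (by omega)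
      omega
  have hafter : ((Finset.Icc 1 d).filter fun j => k < j ∧ lam j < lam k) =
      Finset.Ioc b d := by
    ext j
    simp only [Finset.mem_filter, Finset.mem_Icc, Finset.mem_Ioc]
    constructor
    · rintro ⟨⟨h1, h2⟩, h3, h4⟩
      refine ⟨?_, h2⟩
      by_contra! h
      have := le_of_succ_le_on_Icc hlam h1 h hbd
      omega
    · rintro ⟨h1, h2⟩
      have := le_of_succ_le_on_Icc hlam (show 1 ≤ b + 1 by omega) h1 h2
      omega
  rw [donate, hbefore, hafter, Nat.card_Ico, Nat.card_Ioc]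
  omega

/-- The sum of an arithmetic progression of difference `-2`. -/
lemma sum_Icc_sub_two_mul {a b : ℕ} (hab : a ≤ b) (c : ℤ) :
    ∑ k ∈ Finset.Icc a b, (c - 2 * (k : ℤ)) = ((b : ℤ) + 1 - a) * (c - a - b) := by
  induction b, hab using Nat.le_induction with
  | base => simp; ring
  | succ n hn ih =>
    rw [Finset.sum_Icc_succ_top (by omega), ih]
    push_cast
    ring

theorem staircase_is_legal
    (d : ℕ) (hd : 1 ≤ d) (lam : ℕ → ℕ)
    (hlam : ∀ k, 1 ≤ k → k + 1 ≤ d → lam (k + 1) ≤ lam k)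
    (a b : ℕ) (hB : IsBlock d lam a b) :
    ∑ k ∈ Finset.Icc a b, staircase d lam k = ∑ k ∈ Finset.Icc a b, donate d lam k := by
  rw [← sub_eq_zero, ← Finset.sum_sub_distrib]
  calc ∑ k ∈ Finset.Icc a b, (staircase d lam k - donate d lam k)
      = ∑ k ∈ Finset.Icc a b, ((a : ℤ) + b - 2 * (k : ℤ)) := by
        refine Finset.sum_congr rfl fun k hk => ?_
        rw [donate_eq_of_mem_block hlam hB hk, staircase]
        ring
    _ = 0 := by
        rw [sum_Icc_sub_two_mul hB.2.1]
        ring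
end

section
/- Diagonal Expression Lemma for the staircase estimator: let λ be a Young diagram with at most d rows, let i, j ∈ [d], and assume λ + e_i is again a Young diagram, i.e. i = 1 or λ_{i−1} > λ_i. Then ∑_{k=1}^{d} ∑_{ℓ=1}^{d} (λ↑↑_k · λ↑↑_ℓ + (1/Δ) · λ↑↑_{max(k,ℓ)}) · g(k, ℓ) = (C_i + 1)(C^{λ+e_i}_j + 1) · D_{d→ij}. -/
open Finset

def intOf (lam : ℕ → ℕ) : ℕ → ℤ := fun x => (lam x : ℤ)

/-- `Δ = (λ_j − λ_i) + (i − j) + δ_{ij}`. -/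
def Del (lam : ℕ → ℕ) (i j : ℕ) : ℚ :=
  (((lam j : ℚ) - (lam i : ℚ)) + ((i : ℚ) - (j : ℚ))) + (if i = j then 1 else 0)

/-- The partial-sum function `F(s, t)` of squared two-step Clebsch–Gordan coefficients. -/
def Fcoef (lam : ℕ → ℕ) (i j : ℕ) (s t : ℕ) : ℚ :=
  if s ≤ t then dimRatio (intOf lam) s i * dimRatio (addBox (intOf lam) i) t j
  else
    dimRatio (intOf lam) t j * dimRatio (addBox (intOf lam) j) s i
      + 1 / Del lam i j ^ 2 *
          (dimRatio (intOf lam) t i * dimRatio (addBox (intOf lam) i) s j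
            - dimRatio (intOf lam) t j * dimRatio (addBox (intOf lam) j) s i)

/-- The squared two-step Clebsch–Gordan coefficient `g(k, ℓ)`. -/
def gcoef (lam : ℕ → ℕ) (i j : ℕ) (k l : ℕ) : ℚ :=
  Fcoef lam i j k l - Fcoef lam i j (k - 1) l - Fcoef lam i j k (l - 1)
    + Fcoef lam i j (k - 1) (l - 1)

/-- `D_{s→ij}`. -/
def dimR2 (lam : ℕ → ℕ) (i j s : ℕ) : ℚ :=
  if max i j ≤ s then weylDim s (addBox (addBox (intOf lam) i) j) / weylDim s (intOf lam)
  else 0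

/-- `C^{λ+e_i}_j = λ_j + δ_{ij} − j`. -/
def rowContentAdd (lam : ℕ → ℕ) (i j : ℕ) : ℚ :=
  ((lam j : ℚ) + (if i = j then 1 else 0)) - (j : ℚ)

/-- The factor relating `weylDim (n + 1) μ` to `weylDim n μ`. -/
def weylFactor (n : ℕ) (μ : ℕ → ℤ) : ℚ :=
  ∏ a ∈ Finset.Icc 1 n,
    (((μ a : ℚ) - (μ (n + 1) : ℚ)) + (((n + 1 : ℕ) : ℚ) - (a : ℚ))) / (((n + 1 : ℕ) : ℚ) - (a : ℚ))

lemma weylDim_succ_s13 (n : ℕ) (μ : ℕ → ℤ) :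
    weylDim (n + 1) μ = weylDim n μ * weylFactor n μ := by
  unfold weylDim weylFactor
  rw [Finset.prod_Icc_succ_top (by omega)]
  rw [Finset.Icc_eq_empty (by omega : ¬ n + 1 + 1 ≤ n + 1), Finset.prod_empty, mul_one,
    ← Finset.prod_mul_distrib]
  refine Finset.prod_congr rfl fun a ha => ?_
  rw [Finset.mem_Icc] at ha
  rw [Finset.prod_Icc_succ_top (by omega)]

lemma weylFactor_addBox (n : ℕ) (μ : ℕ → ℤ) (y : ℕ) (hy : 1 ≤ y) (hyn : y ≤ n) :
    weylFactor n (addBox μ y) * ((μ y : ℚ) - μ (n + 1) + ((n : ℚ) + 1 - y))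
      = weylFactor n μ * ((μ y : ℚ) - μ (n + 1) + ((n : ℚ) + 1 - y) + 1) := by
  unfold weylFactor
  have hmem : y ∈ Finset.Icc 1 n := Finset.mem_Icc.2 ⟨hy, hyn⟩
  rw [← Finset.mul_prod_erase _ _ hmem, ← Finset.mul_prod_erase (Finset.Icc 1 n) _ hmem]
  have herase : ∀ a ∈ (Finset.Icc 1 n).erase y,
      ((((addBox μ y) a : ℚ) - ((addBox μ y) (n + 1) : ℚ)) + (((n + 1 : ℕ) : ℚ) - (a : ℚ)))
          / (((n + 1 : ℕ) : ℚ) - (a : ℚ))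
        = (((μ a : ℚ) - (μ (n + 1) : ℚ)) + (((n + 1 : ℕ) : ℚ) - (a : ℚ)))
          / (((n + 1 : ℕ) : ℚ) - (a : ℚ)) := by
    intro a ha
    have h1 : a ≠ y := (Finset.mem_erase.1 ha).1
    have h2 : n + 1 ≠ y := by omega
    simp [addBox, h1, h2]
  rw [Finset.prod_congr rfl herase]
  have h2 : n + 1 ≠ y := by omega
  simp only [addBox, h2, if_true, if_false]
  push_cast
  ring

lemma dimRatio_of_lt (μ : ℕ → ℤ) {k y : ℕ} (h : k < y) : dimRatio μ k y = 0 := by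
  simp [dimRatio, h]

lemma dimRatio_recurrence (n : ℕ) (μ : ℕ → ℤ) (y : ℕ) (hy : 1 ≤ y)
    (hμ : weylDim (n + 1) μ ≠ 0) :
    ((μ y : ℚ) - y - (μ (n + 1) - ((n : ℚ) + 1))) * (dimRatio μ (n + 1) y - dimRatio μ n y)
      = dimRatio μ n y := by
  rcases lt_trichotomy y (n + 1) with h | h | h
  · have h1 := weylFactor_addBox n μ y hy (by omega)
    rw [weylDim_succ_s13] at hμ
    have hw := left_ne_zero_of_mul hμ
    have hf := right_ne_zero_of_mul hμ
    simp only [dimRatio, if_pos (show y ≤ n by omega), if_pos h.le, weylDim_succ_s13]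
    field_simp
    linear_combination weylDim n (addBox μ y) * h1
  · subst h
    rw [dimRatio_of_lt μ (Nat.lt_succ_self n)]
    push_cast
    ring
  · rw [dimRatio_of_lt μ h, dimRatio_of_lt μ (show n < y by omega)]
    ring

/-- The tuple `(μ 1, ..., μ d)` is weakly decreasing. -/
def Dominant (d : ℕ) (μ : ℕ → ℤ) : Prop := ∀ a b, 1 ≤ a → a < b → b ≤ d → μ b ≤ μ a

lemma Dominant.mono {m d : ℕ} {μ : ℕ → ℤ} (h : Dominant d μ) (hmd : m ≤ d) : Dominant m μ :=
  fun a b ha hab hb => h a b ha hab (hb.trans hmd)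

lemma Dominant.weylDim_ne_zero {d : ℕ} {μ : ℕ → ℤ} (h : Dominant d μ) : weylDim d μ ≠ 0 := by
  unfold weylDim
  refine Finset.prod_ne_zero_iff.2 fun a ha => Finset.prod_ne_zero_iff.2 fun b hb => ?_
  rw [Finset.mem_Icc] at ha hb
  have h1 : (μ b : ℚ) ≤ μ a := by exact_mod_cast h a b ha.1 (by omega) hb.2
  have h2 : (a : ℚ) < b := by exact_mod_cast (show a < b by omega)
  exact (div_pos (by linarith) (by linarith)).ne'

lemma weylDim_eq_zero {d : ℕ} {μ : ℕ → ℤ} {a : ℕ} (ha : 1 ≤ a) (had : a + 1 ≤ d)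
    (h : μ (a + 1) = μ a + 1) : weylDim d μ = 0 := by
  unfold weylDim
  refine Finset.prod_eq_zero (Finset.mem_Icc.2 ⟨ha, by omega⟩)
    (Finset.prod_eq_zero (Finset.mem_Icc.2 ⟨le_refl (a + 1), had⟩) ?_)
  rw [h]
  push_cast
  ring

lemma Dominant.addBox {d : ℕ} {μ : ℕ → ℤ} (h : Dominant d μ) {y : ℕ}
    (hy : 2 ≤ y → y ≤ d → μ y < μ (y - 1)) : Dominant d (addBox μ y) := by
  intro a b ha hab hb
  have h1 := h a b ha hab hb
  unfold _root_.addBox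
  by_cases hby : b = y
  · subst hby
    have h2 := hy (by omega) hb
    have h3 : μ (b - 1) ≤ μ a := by
      rcases Nat.lt_or_ge a (b - 1) with h4 | h4
      · exact h a (b - 1) ha h4 (by omega)
      · rw [show a = b - 1 by omega]
    rw [if_pos rfl, if_neg (by omega)]
    omega
  · rw [if_neg hby]
    split_ifs <;> omega

lemma addBox_comm (μ : ℕ → ℤ) (x y : ℕ) : addBox (addBox μ x) y = addBox (addBox μ y) x := by
  funext z
  simp only [addBox]
  ring

lemma dimRatio_mul_dimRatio {m i j : ℕ} {μ : ℕ → ℤ} (hi : i ≤ m) (hj : j ≤ m)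
    (hμ : weylDim m (addBox μ i) ≠ 0) :
    dimRatio μ m i * dimRatio (addBox μ i) m j
      = weylDim m (addBox (addBox μ i) j) / weylDim m μ := by
  simp only [dimRatio, if_pos hi, if_pos hj]
  field_simp

lemma sum_Icc_sub_pred (u : ℕ → ℚ) (n : ℕ) :
    ∑ k ∈ Finset.Icc 1 n, (u k - u (k - 1)) = u n - u 0 := by
  induction n with
  | zero => simp
  | succ n ih => rw [Finset.sum_Icc_succ_top (by omega), ih]; simp

lemma sum_staircase_mul_sub (μ : ℕ → ℤ) (y : ℕ) (hy : 1 ≤ y) (n : ℕ) (hμ : Dominant n μ) :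
    ∑ k ∈ Finset.Icc 1 n, ((μ k : ℚ) - 2 * k + 1 + n) * (dimRatio μ k y - dimRatio μ (k - 1) y)
      = ((μ y : ℚ) - y + 1) * dimRatio μ n y := by
  induction n with
  | zero => simp [dimRatio_of_lt μ (show 0 < y by omega)]
  | succ n ih =>
    have hrec := dimRatio_recurrence n μ y hy hμ.weylDim_ne_zero
    have ih := ih (hμ.mono n.le_succ)
    have htel := sum_Icc_sub_pred (fun k => dimRatio μ k y) n
    simp only [dimRatio_of_lt μ (show 0 < y by omega), sub_zero] at htel
    rw [Finset.sum_Icc_succ_top (by omega)]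
    have hshift : ∑ k ∈ Finset.Icc 1 n, ((μ k : ℚ) - 2 * k + 1 + (n + 1 : ℕ))
          * (dimRatio μ k y - dimRatio μ (k - 1) y)
        = ((μ y : ℚ) - y + 1) * dimRatio μ n y + dimRatio μ n y := by
      rw [← ih, ← htel, ← Finset.sum_add_distrib]
      refine Finset.sum_congr rfl fun k _ => ?_
      push_cast
      ring
    rw [hshift, Nat.add_sub_cancel]
    push_cast
    linear_combination -hrec

/-- The mixed second difference of `F`. -/
def mixedDiff (F : ℕ → ℕ → ℚ) (k l : ℕ) : ℚ :=
  F k l - F (k - 1) l - F k (l - 1) + F (k - 1) (l - 1)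

/-- The weighted sum of the mixed second differences of `F` over `1 ≤ k, l ≤ n`. -/
def staircaseSum (F : ℕ → ℕ → ℚ) (t : ℕ → ℚ) (e : ℚ) (n : ℕ) : ℚ :=
  ∑ k ∈ Finset.Icc 1 n, ∑ l ∈ Finset.Icc 1 n,
    ((t k + n) * (t l + n) + e * (t (max k l) + n)) * mixedDiff F k l

lemma sum_mixedDiff_right (F : ℕ → ℕ → ℚ) (k n : ℕ) (hF : ∀ s, F s 0 = 0) :
    ∑ l ∈ Finset.Icc 1 n, mixedDiff F k l = F k n - F (k - 1) n := by
  have h := sum_Icc_sub_pred (fun l => F k l - F (k - 1) l) n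
  simp only [hF, sub_zero] at h
  rw [← h]
  exact Finset.sum_congr rfl fun l _ => by unfold mixedDiff; ring

lemma sum_mixedDiff_left (F : ℕ → ℕ → ℚ) (l n : ℕ) (hF : ∀ s, F 0 s = 0) :
    ∑ k ∈ Finset.Icc 1 n, mixedDiff F k l = F n l - F n (l - 1) := by
  have h := sum_Icc_sub_pred (fun k => F k l - F k (l - 1)) n
  simp only [hF, sub_zero] at h
  rw [← h]
  exact Finset.sum_congr rfl fun k _ => by unfold mixedDiff; ring

lemma staircaseSum_succ (F : ℕ → ℕ → ℚ) (t : ℕ → ℚ) (e : ℚ) (n : ℕ)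
    (h0 : ∀ s, F 0 s = 0) (h0' : ∀ s, F s 0 = 0) :
    staircaseSum F t e (n + 1) = staircaseSum F t e n
      + ∑ k ∈ Finset.Icc 1 n, (t k + n) *
          ((F k n - F (k - 1) n) + (F n k - F n (k - 1)))
      + (1 + e) * F n n
      + (t (n + 1) + n + 1) * ∑ k ∈ Finset.Icc 1 n, (t k + n) *
          ((F k (n + 1) - F (k - 1) (n + 1)) + (F (n + 1) k - F (n + 1) (k - 1))
            - (F k n - F (k - 1) n) - (F n k - F n (k - 1)))
      + (t (n + 1) + n + 1) * (1 + e) * (F n (n + 1) + F (n + 1) n - 2 * F n n)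
      + ((t (n + 1) + n + 1) ^ 2 + e * (t (n + 1) + n + 1)) *
          (F (n + 1) (n + 1) - F n (n + 1) - F (n + 1) n + F n n) := by
  have hinner : ∑ k ∈ Finset.Icc 1 n, ∑ l ∈ Finset.Icc 1 n,
      ((t k + (n + 1 : ℕ)) * (t l + (n + 1 : ℕ)) + e * (t (max k l) + (n + 1 : ℕ)))
        * mixedDiff F k l
      = staircaseSum F t e n
        + ∑ k ∈ Finset.Icc 1 n, (t k + n) * (F k n - F (k - 1) n)
        + ∑ k ∈ Finset.Icc 1 n, (t k + n) * (F n k - F n (k - 1))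
        + (1 + e) * F n n := by
    have e1 : ∑ k ∈ Finset.Icc 1 n, (t k + n) * (F k n - F (k - 1) n)
        = ∑ k ∈ Finset.Icc 1 n, ∑ l ∈ Finset.Icc 1 n, (t k + n) * mixedDiff F k l :=
      Finset.sum_congr rfl fun k _ => by rw [← Finset.mul_sum, sum_mixedDiff_right F k n h0']
    have e2 : ∑ k ∈ Finset.Icc 1 n, (t k + n) * (F n k - F n (k - 1))
        = ∑ k ∈ Finset.Icc 1 n, ∑ l ∈ Finset.Icc 1 n, (t l + n) * mixedDiff F k l := by
      rw [Finset.sum_comm]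
      exact Finset.sum_congr rfl fun k _ => by rw [← Finset.mul_sum, sum_mixedDiff_left F k n h0]
    have e3 : (1 + e) * F n n
        = ∑ k ∈ Finset.Icc 1 n, ∑ l ∈ Finset.Icc 1 n, (1 + e) * mixedDiff F k l := by
      have h := sum_Icc_sub_pred (fun k => F k n) n
      simp only [h0, sub_zero] at h
      simp only [← Finset.mul_sum, sum_mixedDiff_right F _ n h0', h]
    rw [e1, e2, e3, staircaseSum]
    simp only [← Finset.sum_add_distrib]
    refine Finset.sum_congr rfl fun k _ => Finset.sum_congr rfl fun l _ => ?_
    push_cast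
    ring
  have hcol : ∑ k ∈ Finset.Icc 1 n,
      ((t k + (n + 1 : ℕ)) * (t (n + 1) + (n + 1 : ℕ)) + e * (t (max k (n + 1)) + (n + 1 : ℕ)))
        * mixedDiff F k (n + 1)
      = (t (n + 1) + n + 1) * ∑ k ∈ Finset.Icc 1 n, (t k + n) * mixedDiff F k (n + 1)
        + (t (n + 1) + n + 1) * (1 + e) * (F n (n + 1) - F n n) := by
    have h := sum_mixedDiff_left F (n + 1) n h0
    rw [Nat.add_sub_cancel] at h
    rw [← h, Finset.mul_sum, Finset.mul_sum, ← Finset.sum_add_distrib]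
    refine Finset.sum_congr rfl fun k hk => ?_
    rw [Finset.mem_Icc] at hk
    rw [max_eq_right (by omega : k ≤ n + 1)]
    push_cast
    ring
  have hrow : ∑ l ∈ Finset.Icc 1 n,
      ((t (n + 1) + (n + 1 : ℕ)) * (t l + (n + 1 : ℕ)) + e * (t (max (n + 1) l) + (n + 1 : ℕ)))
        * mixedDiff F (n + 1) l
      = (t (n + 1) + n + 1) * ∑ k ∈ Finset.Icc 1 n, (t k + n) * mixedDiff F (n + 1) k
        + (t (n + 1) + n + 1) * (1 + e) * (F (n + 1) n - F n n) := by
    have h := sum_mixedDiff_right F (n + 1) n h0'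
    rw [Nat.add_sub_cancel] at h
    rw [← h, Finset.mul_sum, Finset.mul_sum, ← Finset.sum_add_distrib]
    refine Finset.sum_congr rfl fun k hk => ?_
    rw [Finset.mem_Icc] at hk
    rw [max_eq_left (by omega : k ≤ n + 1)]
    push_cast
    ring
  have hsplit : ∑ k ∈ Finset.Icc 1 n, (t k + n) *
          ((F k n - F (k - 1) n) + (F n k - F n (k - 1)))
      = ∑ k ∈ Finset.Icc 1 n, (t k + n) * (F k n - F (k - 1) n)
        + ∑ k ∈ Finset.Icc 1 n, (t k + n) * (F n k - F n (k - 1)) := by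
    simp only [mul_add, Finset.sum_add_distrib]
  have hsplit' : ∑ k ∈ Finset.Icc 1 n, (t k + n) *
          ((F k (n + 1) - F (k - 1) (n + 1)) + (F (n + 1) k - F (n + 1) (k - 1))
            - (F k n - F (k - 1) n) - (F n k - F n (k - 1)))
      = ∑ k ∈ Finset.Icc 1 n, (t k + n) * mixedDiff F k (n + 1)
        + ∑ k ∈ Finset.Icc 1 n, (t k + n) * mixedDiff F (n + 1) k := by
    rw [← Finset.sum_add_distrib]
    refine Finset.sum_congr rfl fun k _ => ?_
    simp only [mixedDiff, Nat.add_sub_cancel]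
    ring
  rw [hsplit, hsplit', staircaseSum, Finset.sum_Icc_succ_top (by omega)]
  simp only [Finset.sum_Icc_succ_top (show 1 ≤ n + 1 by omega), Finset.sum_add_distrib]
  rw [hinner, hcol, hrow]
  simp only [mixedDiff, Nat.add_sub_cancel, max_self]
  push_cast
  ring

lemma staircaseSum_succ_of_split (F : ℕ → ℕ → ℚ) (t : ℕ → ℚ) (e q r A B : ℚ) (n : ℕ)
    (a b a' b' : ℕ → ℚ) (ha : a 0 = 0)
    (hF : ∀ s u, s ≤ u → F s u = a s * b' u)
    (hF0 : ∀ s, F s 0 = 0)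
    (hF' : ∀ s u, s ≤ n + 1 → u ≤ s → F s u = q * (b u * a' s) + r * (a u * b' s))
    (hA : ∑ k ∈ Finset.Icc 1 n, (t k + n) * (a k - a (k - 1)) = A * a n)
    (hB : ∑ k ∈ Finset.Icc 1 n, (t k + n) * (b k - b (k - 1)) = B * b n) :
    staircaseSum F t e (n + 1) = staircaseSum F t e n
      + ((1 + r) * A * (a n * b' n) + q * B * (b n * a' n))
      + (1 + e) * (a n * b' n)
      + (t (n + 1) + n + 1) * ((1 + r) * A * (a n * b' (n + 1) - a n * b' n)
          + q * B * (b n * a' (n + 1) - b n * a' n))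
      + (t (n + 1) + n + 1) * (1 + e) *
          ((1 + r) * (a n * b' (n + 1)) + q * (b n * a' (n + 1)) - 2 * (a n * b' n))
      + ((t (n + 1) + n + 1) ^ 2 + e * (t (n + 1) + n + 1)) *
          (a (n + 1) * b' (n + 1) - (1 + r) * (a n * b' (n + 1)) - q * (b n * a' (n + 1))
            + a n * b' n) := by
  have key : ∀ m, n ≤ m → m ≤ n + 1 → ∑ k ∈ Finset.Icc 1 n, (t k + n) *
        ((F k m - F (k - 1) m) + (F m k - F m (k - 1)))
      = (1 + r) * A * (a n * b' m) + q * B * (b n * a' m) := by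
    intro m hm hm'
    have : (1 + r) * A * (a n * b' m) + q * B * (b n * a' m)
        = (1 + r) * b' m * (A * a n) + q * a' m * (B * b n) := by ring
    rw [this, ← hA, ← hB, Finset.mul_sum, Finset.mul_sum, ← Finset.sum_add_distrib]
    refine Finset.sum_congr rfl fun k hk => ?_
    rw [Finset.mem_Icc] at hk
    rw [hF k m (by omega), hF (k - 1) m (by omega), hF' m k hm' (by omega), hF' m (k - 1) hm' (by omega)]
    ring
  rw [staircaseSum_succ F t e n (fun s => by rw [hF 0 s (Nat.zero_le s), ha, zero_mul])
    hF0]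
  have hK : ∑ k ∈ Finset.Icc 1 n, (t k + n) *
          ((F k (n + 1) - F (k - 1) (n + 1)) + (F (n + 1) k - F (n + 1) (k - 1))
            - (F k n - F (k - 1) n) - (F n k - F n (k - 1)))
      = ((1 + r) * A * (a n * b' (n + 1)) + q * B * (b n * a' (n + 1)))
        - ((1 + r) * A * (a n * b' n) + q * B * (b n * a' n)) := by
    rw [← key n le_rfl n.le_succ, ← key (n + 1) n.le_succ le_rfl, ← Finset.sum_sub_distrib]
    exact Finset.sum_congr rfl fun k _ => by ring
  rw [hK, key n le_rfl n.le_succ, hF n n le_rfl, hF n (n + 1) n.le_succ, hF' (n + 1) n le_rfl n.le_succ,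
    hF (n + 1) (n + 1) le_rfl]
  ring

lemma dominant_or_dimRatio_eq_zero {d : ℕ} {μ : ℕ → ℤ} (h : Dominant d μ) (y : ℕ) :
    Dominant d (addBox μ y) ∨ ∀ m, dimRatio μ m y = 0 := by
  by_cases hy : 2 ≤ y → y ≤ d → μ y < μ (y - 1)
  · exact Or.inl (h.addBox hy)
  · right
    push Not at hy
    obtain ⟨h2, hyd, hle⟩ := hy
    intro m
    rcases Nat.lt_or_ge m y with hm | hm
    · exact dimRatio_of_lt μ hm
    · have heq : μ y = μ (y - 1) := le_antisymm (h (y - 1) y (by omega) (by omega) hyd) hle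
      have hz : weylDim m (addBox μ y) = 0 := by
        refine weylDim_eq_zero (a := y - 1) (by omega) (by omega) ?_
        rw [show y - 1 + 1 = y by omega]
        simp only [addBox, if_true, if_neg (show y - 1 ≠ y by omega)]
        omega
      simp [dimRatio, hz]

lemma one_sub_Del_mul_comm {d : ℕ} (lam : ℕ → ℕ) (hlam : Dominant d (intOf lam)) (i j : ℕ)
    (hj : 1 ≤ j) (hi : Dominant d (addBox (intOf lam) i)) {m : ℕ} (hm : m ≤ d) :
    (1 - 1 / Del lam i j ^ 2) * (dimRatio (intOf lam) m j * dimRatio (addBox (intOf lam) j) m i)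
      = (1 - 1 / Del lam i j ^ 2)
        * (dimRatio (intOf lam) m i * dimRatio (addBox (intOf lam) i) m j) := by
  rcases Nat.lt_or_ge m i with hmi | hmi
  · rw [dimRatio_of_lt _ hmi, dimRatio_of_lt _ hmi, mul_zero, zero_mul]
  rcases Nat.lt_or_ge m j with hmj | hmj
  · rw [dimRatio_of_lt _ hmj, dimRatio_of_lt _ hmj, mul_zero, zero_mul]
  rw [dimRatio_mul_dimRatio hmi hmj (hi.mono hm).weylDim_ne_zero]
  by_cases hval : 2 ≤ j → j ≤ d → intOf lam j < intOf lam (j - 1)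
  · rw [dimRatio_mul_dimRatio hmj hmi ((hlam.addBox hval).mono hm).weylDim_ne_zero, addBox_comm]
  · push Not at hval
    obtain ⟨h2, hjd, hle⟩ := hval
    have heq : intOf lam j = intOf lam (j - 1) :=
      le_antisymm (hlam (j - 1) j (by omega) (by omega) hjd) hle
    have hij : i ≠ j := by
      rintro rfl
      have h3 := hi (i - 1) i (by omega) (by omega) hjd
      simp only [addBox, if_true, if_neg (show i - 1 ≠ i by omega)] at h3
      omega
    by_cases hij' : i = j - 1
    · have hDel : Del lam i j = -1 := by
        have h4 : (lam j : ℚ) = lam i := by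
          simp only [intOf] at heq
          rw [hij']
          exact_mod_cast heq
        have h5 : (j : ℚ) = i + 1 := by exact_mod_cast (show j = i + 1 by omega)
        rw [Del, if_neg hij, h4, h5]
        ring
      rw [hDel]
      norm_num
    · have hz : ∀ ν : ℕ → ℤ, (∀ x, ν x = intOf lam x ∨ x = i ∨ x = j) →
          ν j = intOf lam j + 1 → weylDim m ν = 0 := by
        intro ν hν hνj
        refine weylDim_eq_zero (a := j - 1) (by omega) (by omega) ?_
        rw [show j - 1 + 1 = j by omega, hνj]
        rcases hν (j - 1) with h | h | h <;> omega
      have hz1 : weylDim m (addBox (intOf lam) j) = 0 :=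
        hz _ (fun x => by by_cases h : x = j <;> simp [addBox, h]) (by simp [addBox])
      have hz2 : weylDim m (addBox (addBox (intOf lam) i) j) = 0 :=
        hz _ (fun x => by by_cases h : x = j <;> by_cases h' : x = i <;> simp [addBox, h, h'])
          (by simp [addBox, hij.symm])
      rw [hz2]
      simp [dimRatio, hz1]

lemma Del_ne_zero {d : ℕ} (lam : ℕ → ℕ) (hlam : Dominant d (intOf lam)) {i j : ℕ}
    (hi : i ∈ Finset.Icc 1 d) (hj : j ∈ Finset.Icc 1 d) : Del lam i j ≠ 0 := by
  rw [Finset.mem_Icc] at hi hj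
  unfold Del
  rcases lt_trichotomy i j with h | h | h
  · have h1 := hlam i j hi.1 h hj.2
    have h2 : (lam j : ℚ) ≤ lam i := by simpa [intOf] using h1
    have h3 : (i : ℚ) < j := by exact_mod_cast h
    rw [if_neg h.ne]
    linarith
  · subst h
    simp
  · have h1 := hlam j i hj.1 h hi.2
    have h2 : (lam i : ℚ) ≤ lam j := by simpa [intOf] using h1
    have h3 : (j : ℚ) < i := by exact_mod_cast h
    rw [if_neg h.ne']
    linarith

lemma Fcoef_of_le (lam : ℕ → ℕ) (i j s u : ℕ) (h : s ≤ u) :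
    Fcoef lam i j s u = dimRatio (intOf lam) s i * dimRatio (addBox (intOf lam) i) u j :=
  if_pos h

lemma Fcoef_of_ge {d : ℕ} (lam : ℕ → ℕ) (hlam : Dominant d (intOf lam)) (i j : ℕ)
    (hj : 1 ≤ j) (hi : Dominant d (addBox (intOf lam) i)) (s u : ℕ) (hs : s ≤ d) (h : u ≤ s) :
    Fcoef lam i j s u
      = (1 - 1 / Del lam i j ^ 2)
          * (dimRatio (intOf lam) u j * dimRatio (addBox (intOf lam) j) s i)
        + 1 / Del lam i j ^ 2
          * (dimRatio (intOf lam) u i * dimRatio (addBox (intOf lam) i) s j) := by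
  rcases h.eq_or_lt with rfl | h
  · rw [Fcoef_of_le _ _ _ _ _ le_rfl, one_sub_Del_mul_comm lam hlam i j hj hi hs]
    ring
  · rw [Fcoef, if_neg (by omega)]
    ring

/-- Induction step for a row `n + 1` below both `i` and `j`. -/
lemma staircase_step_below (A c D B a a1 b a' a1' b' b1' : ℚ) (hD : D ≠ 0) (hx : A - c ≠ 0)
    (hy : A + D - c ≠ 0) (ha : (A - c) * (a1 - a) = a) (hb' : (A + D - c) * (b1' - b') = b')
    (hB : (1 - 1 / D ^ 2) * B = (1 - 1 / D ^ 2) * (A + D))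
    (hba : (1 - 1 / D ^ 2) * (b * a') = (1 - 1 / D ^ 2) * (a * b'))
    (ha' : (1 - 1 / D ^ 2) * ((A - c) * (b * a1' - b * a'))
      = (1 - 1 / D ^ 2) * (b * a')) :
    (A + 1) * (A + D + 1) * (a * b')
      + ((1 + 1 / D ^ 2) * (A + 1) * (a * b') + (1 - 1 / D ^ 2) * (B + 1) * (b * a'))
      + (1 + 1 / D) * (a * b')
      + (c + 1) * ((1 + 1 / D ^ 2) * (A + 1) * (a * b1' - a * b')
          + (1 - 1 / D ^ 2) * (B + 1) * (b * a1' - b * a'))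
      + (c + 1) * (1 + 1 / D) *
          ((1 + 1 / D ^ 2) * (a * b1') + (1 - 1 / D ^ 2) * (b * a1') - 2 * (a * b'))
      + ((c + 1) ^ 2 + 1 / D * (c + 1)) *
          (a1 * b1' - (1 + 1 / D ^ 2) * (a * b1') - (1 - 1 / D ^ 2) * (b * a1') + a * b')
      = (A + 1) * (A + D + 1) * (a1 * b1') := by
  have h1 : a1 = a * (1 + 1 / (A - c)) := by
    field_simp
    linear_combination ha
  have h2 : b1' = b' * (1 + 1 / (A + D - c)) := by
    field_simp
    linear_combination hb'
  have h3 : (1 - 1 / D ^ 2) * (b * a1')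
      = (1 - 1 / D ^ 2) * (a * b') * (1 + 1 / (A - c)) := by
    have h4 : (A - c) * ((1 - 1 / D ^ 2) * (b * a1'))
        = (1 - 1 / D ^ 2) * (a * b') * (A - c + 1) := by
      linear_combination ha' + (A - c + 1) * hba
    refine mul_left_cancel₀ hx ?_
    rw [h4]
    field_simp
  have h5 : (1 - 1 / D ^ 2) * (B + 1) * (b * a')
      = (A + D + 1) * ((1 - 1 / D ^ 2) * (a * b')) := by
    linear_combination b * a' * hB + (A + D + 1) * hba
  have h6 : (1 - 1 / D ^ 2) * (B + 1) * (b * a1' - b * a')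
      = (A + D + 1) * ((1 - 1 / D ^ 2) * (a * b')) * (1 / (A - c)) := by
    linear_combination (b * a1' - b * a') * hB + (A + D + 1) * h3 - (A + D + 1) * hba
  rw [h5, h6, h3, h1, h2]
  field_simp
  ring

/-- Induction step for the row `n + 1 = i`, when `j < i`. -/
lemma staircase_step_left (A D a1 b b1 a1' b1' : ℚ) (hD : D ≠ 0)
    (hb : D * (b1 - b) = b)
    (hba : (1 - 1 / D ^ 2) * (b1 * a1') = (1 - 1 / D ^ 2) * (a1 * b1')) :
    (A + 1) * ((1 - 1 / D ^ 2) * (A + D + 1) * (b * a1'))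
      + (A + 1) * (1 + 1 / D) * ((1 - 1 / D ^ 2) * (b * a1'))
      + ((A + 1) ^ 2 + 1 / D * (A + 1)) * (a1 * b1' - (1 - 1 / D ^ 2) * (b * a1'))
      = (A + 1) * (A + D + 1) * (a1 * b1') := by
  have h1 : b1 = b * (1 + 1 / D) := by
    field_simp
    linear_combination hb
  rw [h1] at hba
  have hu : D * (1 / D) = 1 := mul_one_div_cancel hD
  linear_combination (A + 1) * D * hba
    - (A + 1) * ((1 - 1 / D ^ 2) * (b * a1') + 1 / D * (a1 * b1')) * hu

/-- Induction step for the row `n + 1 = j`, when `i < j`. -/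
lemma staircase_step_right (A D a a1 b1' : ℚ) (hD : D ≠ 0) (ha : (-D) * (a1 - a) = a) :
    (A + D + 1) * ((1 + 1 / D ^ 2) * (A + 1) * (a * b1'))
      + (A + D + 1) * (1 + 1 / D) * ((1 + 1 / D ^ 2) * (a * b1'))
      + ((A + D + 1) ^ 2 + 1 / D * (A + D + 1)) * (a1 * b1' - (1 + 1 / D ^ 2) * (a * b1'))
      = (A + 1) * (A + D + 1) * (a1 * b1') := by
  have h1 : a1 = a * (1 - 1 / D) := by
    field_simp
    linear_combination -ha
  rw [h1]
  field_simp
  ring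

lemma staircaseSum_Fcoef {d : ℕ} (lam : ℕ → ℕ) (hlam : Dominant d (intOf lam)) {i j : ℕ}
    (hi : i ∈ Finset.Icc 1 d) (hj : j ∈ Finset.Icc 1 d)
    (hival : Dominant d (addBox (intOf lam) i)) (n : ℕ) (hn : n ≤ d) :
    staircaseSum (Fcoef lam i j) (fun k => (lam k : ℚ) - 2 * k + 1) (1 / Del lam i j) n
      = (rowContent lam i + 1) * (rowContent lam i + Del lam i j + 1)
          * (dimRatio (intOf lam) n i * dimRatio (addBox (intOf lam) i) n j) := by
  have hD := Del_ne_zero lam hlam hi hj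
  rw [Finset.mem_Icc] at hi hj
  induction n with
  | zero => simp [staircaseSum, dimRatio_of_lt _ (show 0 < i by omega)]
  | succ n ih =>
    have ih := ih (by omega)
    have hsucc := staircaseSum_succ_of_split (Fcoef lam i j) (fun k => (lam k : ℚ) - 2 * k + 1)
      (1 / Del lam i j) (1 - 1 / Del lam i j ^ 2) (1 / Del lam i j ^ 2)
      (rowContent lam i + 1) (rowContent lam j + 1) n
      (fun k => dimRatio (intOf lam) k i) (fun k => dimRatio (intOf lam) k j)
      (fun k => dimRatio (addBox (intOf lam) j) k i)
      (fun k => dimRatio (addBox (intOf lam) i) k j)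
      (dimRatio_of_lt _ (by omega))
      (fun s u h => Fcoef_of_le lam i j s u h)
      (fun s => by
        simp [Fcoef, dimRatio_of_lt _ (show 0 < i by omega), dimRatio_of_lt _ (show 0 < j by omega)])
      (fun s u hs h => Fcoef_of_ge lam hlam i j hj.1 hival s u (by omega) h)
      (by simpa [intOf, rowContent] using
        sum_staircase_mul_sub (intOf lam) i hi.1 n (hlam.mono (by omega)))
      (by simpa [intOf, rowContent] using
        sum_staircase_mul_sub (intOf lam) j hj.1 n (hlam.mono (by omega)))
    have hcons := one_sub_Del_mul_comm lam hlam i j hj.1 hival (show n ≤ d by omega)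
    have hcons' := one_sub_Del_mul_comm lam hlam i j hj.1 hival hn
    have hreca := dimRatio_recurrence n (intOf lam) i hi.1 (hlam.mono hn).weylDim_ne_zero
    have hrecb := dimRatio_recurrence n (intOf lam) j hj.1 (hlam.mono hn).weylDim_ne_zero
    have hrecb' := dimRatio_recurrence n (addBox (intOf lam) i) j hj.1
      (hival.mono hn).weylDim_ne_zero
    have hreca' : dimRatio (intOf lam) n j * ((((addBox (intOf lam) j i : ℤ) : ℚ) - i
          - ((addBox (intOf lam) j (n + 1) : ℤ) - ((n : ℚ) + 1)))
          * (dimRatio (addBox (intOf lam) j) (n + 1) i - dimRatio (addBox (intOf lam) j) n i))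
        = dimRatio (intOf lam) n j * dimRatio (addBox (intOf lam) j) n i := by
      rcases dominant_or_dimRatio_eq_zero hlam j with h | h
      · rw [dimRatio_recurrence n (addBox (intOf lam) j) i hi.1 (h.mono hn).weylDim_ne_zero]
      · rw [h, zero_mul, zero_mul]
    have hDel : (lam j : ℚ) - j + (if i = j then 1 else 0) = lam i - i + Del lam i j := by
      unfold Del
      ring
    rw [hsucc, ih]
    clear hsucc ih
    have hza := dimRatio_of_lt (intOf lam) (k := n) (y := i)
    have hza1 := dimRatio_of_lt (intOf lam) (k := n + 1) (y := i)
    have hza' := dimRatio_of_lt (addBox (intOf lam) j) (k := n) (y := i)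
    have hza1' := dimRatio_of_lt (addBox (intOf lam) j) (k := n + 1) (y := i)
    have hzb := dimRatio_of_lt (intOf lam) (k := n) (y := j)
    have hzb' := dimRatio_of_lt (addBox (intOf lam) i) (k := n) (y := j)
    have hzb1' := dimRatio_of_lt (addBox (intOf lam) i) (k := n + 1) (y := j)
    have hposi : i ≤ n → (0 : ℚ) < lam i - i - (lam (n + 1) - (n + 1)) := fun h => by
      have h1 : (lam (n + 1) : ℚ) ≤ lam i := by
        simpa [intOf] using hlam i (n + 1) hi.1 (by omega) hn
      have h2 : (i : ℚ) ≤ n := by exact_mod_cast h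
      linarith
    have hposj : j ≤ n → (0 : ℚ) < lam i - i + Del lam i j - (lam (n + 1) - (n + 1)) := fun h => by
      have h1 : (lam (n + 1) : ℚ) ≤ lam j := by
        simpa [intOf] using hlam j (n + 1) hj.1 (by omega) hn
      have h2 : (j : ℚ) ≤ n := by exact_mod_cast h
      have h3 : (0 : ℚ) ≤ if i = j then 1 else 0 := by split_ifs <;> norm_num
      linarith
    have hDel1 : i = j → Del lam i j = 1 := by
      rintro rfl
      simp [Del]
    simp only [rowContent]
    have hbox : ∀ x y, ((addBox (intOf lam) x y : ℤ) : ℚ) = lam y + if y = x then 1 else 0 := by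
      intro x y
      simp [addBox, intOf]
    have hint : ∀ x, ((intOf lam x : ℤ) : ℚ) = lam x := fun x => by simp [intOf]
    simp only [hbox, hint] at hreca hrecb hrecb' hreca'
    clear hbox hint hlam hival
    push_cast at *
    generalize dimRatio (intOf lam) n i = a at *
    generalize dimRatio (intOf lam) (n + 1) i = a1 at *
    generalize dimRatio (intOf lam) n j = b at *
    generalize dimRatio (intOf lam) (n + 1) j = b1 at *
    generalize dimRatio (addBox (intOf lam) j) n i = a' at *
    generalize dimRatio (addBox (intOf lam) j) (n + 1) i = a1' at *
    generalize dimRatio (addBox (intOf lam) i) n j = b' at *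
    generalize dimRatio (addBox (intOf lam) i) (n + 1) j = b1' at *
    generalize Del lam i j = D at *
    rcases Nat.lt_or_ge (n + 1) (max i j) with hlt | hge
    · rcases lt_max_iff.1 hlt with h | h
      · rw [hza (by omega), hza1 h, hza' (by omega)]
        rw [hza1' h]
        ring
      · rw [hzb (by omega), hzb' (by omega), hzb1' h]
        ring
    rw [ge_iff_le, max_le_iff] at hge
    rcases hge.1.eq_or_lt with hin | hin
    · have ha0 : a = 0 := hza (by omega)
      have ha0' : a' = 0 := hza' (by omega)
      rcases hge.2.eq_or_lt with hjn | hjn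
      · have hb0 : b = 0 := hzb (by omega)
        rw [hDel1 (by omega), ha0, hb0, hin]
        push_cast
        ring
      · have hij : i ≠ j := by omega
        have hlamj : (lam j : ℚ) = lam i - i + D + j := by
          rw [if_neg hij] at hDel
          linarith
        have hin' : ((n : ℚ) + 1) = i := by exact_mod_cast hin.symm
        rw [← hin, hlamj, hin'] at hrecb
        have h := staircase_step_left (lam i - i) D a1 b b1 a1' b1' hD
          (by linear_combination hrecb) hcons'
        rw [← h, ha0, ha0', ← hin, hlamj, show (n : ℚ) = i - 1 by linarith]
        ring
    · rcases hge.2.eq_or_lt with hjn | hjn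
      · have hij : i ≠ j := by omega
        have hb0 : b = 0 := hzb (by omega)
        have hb0' : b' = 0 := hzb' (by omega)
        have hlamj : (lam j : ℚ) = lam i - i + D + j := by
          rw [if_neg hij] at hDel
          linarith
        have hjn' : ((n : ℚ) + 1) = j := by exact_mod_cast hjn.symm
        rw [← hjn, hlamj, hjn'] at hreca
        have h := staircase_step_right (lam i - i) D a a1 b1' hD
          (by linear_combination hreca)
        rw [← h, hb0, hb0', ← hjn, hlamj, show (n : ℚ) = j - 1 by linarith]
        ring
      · have h := staircase_step_below (lam i - i) (lam (n + 1) - (n + 1)) D (lam j - j)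
          a a1 b a' a1' b' b1' hD (hposi (by omega)).ne' (hposj (by omega)).ne' hreca
          (by
            rw [if_neg (show n + 1 ≠ i by omega)] at hrecb'
            simp only [eq_comm (a := j) (b := i)] at hrecb'
            linear_combination hrecb' - (b1' - b') * hDel)
          (by
            by_cases hij : i = j
            · rw [hDel1 hij]
              norm_num
            · rw [if_neg hij] at hDel
              linear_combination (1 - 1 / D ^ 2) * hDel)
          hcons
          (by
            by_cases hij : i = j
            · rw [hDel1 hij]
              norm_num
            · rw [if_neg hij, if_neg (show n + 1 ≠ j by omega)] at hreca'
              linear_combination (1 - 1 / D ^ 2) * hreca')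
        rw [← h]
        ring

theorem diagonal_expression_staircase
    (d : ℕ) (hd : 1 ≤ d) (lam : ℕ → ℕ)
    (hlam : ∀ k, 1 ≤ k → k + 1 ≤ d → lam (k + 1) ≤ lam k)
    (i j : ℕ) (hi : i ∈ Finset.Icc 1 d) (hj : j ∈ Finset.Icc 1 d)
    (hvalid : i = 1 ∨ lam i < lam (i - 1)) :
    ∑ k ∈ Finset.Icc 1 d, ∑ l ∈ Finset.Icc 1 d,
        ((staircase d lam k : ℚ) * (staircase d lam l : ℚ)
            + 1 / Del lam i j * (staircase d lam (max k l) : ℚ)) * gcoef lam i j k l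
      = (rowContent lam i + 1) * (rowContentAdd lam i j + 1) * dimR2 lam i j d := by
  have hmono : ∀ a b, 1 ≤ a → a ≤ b → b ≤ d → lam b ≤ lam a := by
    intro a b ha hab
    induction b, hab using Nat.le_induction with
    | base => exact fun _ => le_rfl
    | succ b hab ih => exact fun hb => (hlam b (ha.trans hab) hb).trans (ih (by omega))
  have hdom : Dominant d (intOf lam) := fun a b ha hab hb => by
    simpa [intOf] using hmono a b ha hab.le hb
  have hival : Dominant d (addBox (intOf lam) i) := hdom.addBox fun h2 _ => by
    have h : lam i < lam (i - 1) := hvalid.resolve_left (by omega)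
    simpa [intOf] using h
  have h := staircaseSum_Fcoef lam hdom hi hj hival d le_rfl
  rw [Finset.mem_Icc] at hi hj
  rw [dimRatio_mul_dimRatio hi.2 hj.2 hival.weylDim_ne_zero] at h
  have hC : rowContentAdd lam i j = rowContent lam i + Del lam i j := by
    unfold rowContentAdd rowContent Del
    ring
  rw [dimR2, if_pos (max_le hi.2 hj.2), hC, ← h, staircaseSum]
  refine Finset.sum_congr rfl fun k _ => Finset.sum_congr rfl fun l _ => ?_
  simp only [staircase, gcoef, mixedDiff]
  push_cast
  ring
end
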